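/- Fix the canonical reduced expression w_0 = (s_1)(s_2 s_1)···(s_{n-1}···s_2 s_1) for the longest element of S_n, and for each v ∈ S_n let PDS(v) be its positive distinguished subexpression within this word. Then the set PDS(n) = {PDS(v) : v ∈ S_n} is closed under truncation: removing any number of simple reflections from the left of an element of PDS(n) yields again an element of PDS(n). -/

import Mathlib

/-- The Coxeter length of a permutation of `Fin n`: its number of inversions. -/
def permLen {n : ℕ} (σ : Equiv.Perm (Fin n)) : ℕ :=
  (Finset.univ.filter (fun p : Fin n × Fin n => p.1 < p.2 ∧ σ p.2 < σ p.1)).card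

/-- The simple transposition `s_a = (a, a+1)` of `Fin n` (as an element of `S_n`),
defined to be the identity if `a + 1 ≥ n`.  (Here positions are 0-indexed, so `sT n a`
corresponds to the simple transposition `s_{a+1}` in 1-indexed notation.) -/
def sT (n : ℕ) (a : ℕ) : Equiv.Perm (Fin n) :=
  if h : a + 1 < n then Equiv.swap ⟨a, Nat.lt_of_succ_lt h⟩ ⟨a + 1, h⟩ else 1

/-- The group element of the expression `s_{i_t} ⋯ s_{i_1}` encoded by the list
`[i_t, …, i_1]` (leftmost letter first), where permutations are multiplied left to right
(i.e. acting on the right), so that `exprProd (a :: l) = exprProd l * sT n a`. -/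
def exprProd (n : ℕ) (l : List ℕ) : Equiv.Perm (Fin n) :=
  l.foldr (fun a g => g * sT n a) 1

/-- A word is reduced if its length equals the Coxeter length of its product. -/
def IsReducedW (n : ℕ) (l : List ℕ) : Prop :=
  permLen (exprProd n l) = l.length

/-- Greedy right-to-left computation of the positive distinguished subexpression:
the input list is the word read from the right (`ω.reverse`); the state is
`v_{(j)}`, and a letter is selected exactly when right-multiplying by it decreases
length.  Returns the final state `v_{(t)}` together with the selected letters in
processing order (right to left). -/
def pdsAux (n : ℕ) : Equiv.Perm (Fin n) → List ℕ → Equiv.Perm (Fin n) × List ℕ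
  | v, [] => (v, [])
  | v, a :: rest =>
    if permLen (sT n a * v) < permLen v then
      ((pdsAux n (sT n a * v) rest).1, a :: (pdsAux n (sT n a * v) rest).2)
    else pdsAux n v rest

/-- The positive distinguished subexpression of `v` inside the word `ω`
(read in word order, leftmost letter first). -/
def pds (n : ℕ) (v : Equiv.Perm (Fin n)) (ω : List ℕ) : List ℕ :=
  (pdsAux n v ω.reverse).2.reverse

/-- The canonical reduced word `(s_1)(s_2 s_1)⋯(s_{n-1}⋯s_2 s_1)` for the longest element
of `S_n` (0-indexed letters: `[0] ++ [1,0] ++ ⋯ ++ [n-2,…,1,0]`). -/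
def w0word (n : ℕ) : List ℕ :=
  (List.range (n - 1)).flatMap (fun j => (List.range (j + 1)).reverse)

/-- The positive distinguished subexpression of `v` inside the canonical reduced word
for the longest element of `S_n`. -/
def PDSw (n : ℕ) (v : Equiv.Perm (Fin n)) : List ℕ := pds n v (w0word n)

theorem sT_mul_self (n a : ℕ) : sT n a * sT n a = 1 := by
  unfold sT; split <;> simp

theorem sT_mul_cancel_left (n a : ℕ) (v : Equiv.Perm (Fin n)) : sT n a * (sT n a * v) = v := by
  rw [← mul_assoc, sT_mul_self, one_mul]

theorem sT_inv (n a : ℕ) : (sT n a)⁻¹ = sT n a :=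
  inv_eq_of_mul_eq_one_left (sT_mul_self n a)

theorem sT_mul_inv_apply (n a : ℕ) (v : Equiv.Perm (Fin n)) (i : Fin n) :
    (sT n a * v)⁻¹ i = v⁻¹ (sT n a i) := by
  rw [mul_inv_rev, sT_inv, Equiv.Perm.mul_apply]

/-- A simple transposition reverses the order of exactly one pair. -/
theorem sT_lt_sT_or (n a : ℕ) {i j : Fin n} (hij : i < j) :
    sT n a i < sT n a j ∨ (i.val = a ∧ j.val = a + 1) := by
  unfold sT
  split
  · simp only [Equiv.swap_apply_def, Fin.lt_def, Fin.ext_iff] at *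
    split_ifs <;> grind
  · left; simpa using hij

theorem sT_apply_left {n a : ℕ} (h : a + 1 < n) :
    sT n a ⟨a, Nat.lt_of_succ_lt h⟩ = ⟨a + 1, h⟩ := by
  simp [sT, h]

theorem sT_apply_right {n a : ℕ} (h : a + 1 < n) :
    sT n a ⟨a + 1, h⟩ = ⟨a, Nat.lt_of_succ_lt h⟩ := by
  simp [sT, h]

theorem permLen_sT_mul_lt_of_lt {n a : ℕ} (h : a + 1 < n) (v : Equiv.Perm (Fin n))
    (hv : v⁻¹ ⟨a + 1, h⟩ < v⁻¹ ⟨a, Nat.lt_of_succ_lt h⟩) :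
    permLen (sT n a * v) < permLen v := by
  apply Finset.card_lt_card
  rw [Finset.ssubset_iff_of_subset]
  · refine ⟨(v⁻¹ ⟨a + 1, h⟩, v⁻¹ ⟨a, Nat.lt_of_succ_lt h⟩), ?_, ?_⟩
    · simpa using hv
    · rw [Finset.mem_filter_univ]
      simp [sT_apply_left h, sT_apply_right h]
  · rintro ⟨p, q⟩ hpq
    rw [Finset.mem_filter_univ] at hpq ⊢
    refine ⟨hpq.1, ?_⟩
    by_contra hn
    have hlt : v p < v q :=
      lt_of_le_of_ne (not_lt.mp hn) (fun e => hpq.1.ne (v.injective e))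
    rcases sT_lt_sT_or n a hlt with h' | ⟨h₁, h₂⟩
    · exact lt_asymm h' hpq.2
    · have e₁ : v p = ⟨a, Nat.lt_of_succ_lt h⟩ := Fin.ext h₁
      have e₂ : v q = ⟨a + 1, h⟩ := Fin.ext h₂
      rw [← e₁, ← e₂, ← Equiv.Perm.mul_apply, ← Equiv.Perm.mul_apply, inv_mul_cancel] at hv
      exact lt_asymm hv hpq.1

/-- Multiplying by `s_a` decreases the length exactly when the values `a`, `a + 1` are inverted. -/
theorem permLen_sT_mul_lt_iff (n a : ℕ) (v : Equiv.Perm (Fin n)) :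
    permLen (sT n a * v) < permLen v ↔
      ∃ h : a + 1 < n, v⁻¹ ⟨a + 1, h⟩ < v⁻¹ ⟨a, Nat.lt_of_succ_lt h⟩ := by
  refine ⟨fun hlt => ?_, fun ⟨h, hv⟩ => permLen_sT_mul_lt_of_lt h v hv⟩
  by_cases h : a + 1 < n
  · refine ⟨h, ?_⟩
    by_contra hn
    have hne : v⁻¹ ⟨a, Nat.lt_of_succ_lt h⟩ ≠ v⁻¹ ⟨a + 1, h⟩ := by simp
    have hw := permLen_sT_mul_lt_of_lt h (sT n a * v) (by
      rw [sT_mul_inv_apply, sT_mul_inv_apply, sT_apply_left h, sT_apply_right h]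
      exact lt_of_le_of_ne (not_lt.mp hn) hne)
    rw [sT_mul_cancel_left] at hw
    exact lt_asymm hlt hw
  · simp [sT, h] at hlt

theorem pdsAux_one (n : ℕ) (ω : List ℕ) : (pdsAux n 1 ω).2 = [] := by
  induction ω with
  | nil => rfl
  | cons a ω ih =>
    have h : ¬ permLen (sT n a * 1) < permLen (1 : Equiv.Perm (Fin n)) := by
      rw [permLen_sT_mul_lt_iff]
      rintro ⟨h, h'⟩
      simp [Fin.lt_def] at h'
    rw [pdsAux, if_neg h, ih]

/-- Every inverted pair of values of `u` is an inverted pair of values of `v`; equivalently,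
`u` lies below `v` in a weak order. -/
def InvLE {n : ℕ} (u v : Equiv.Perm (Fin n)) : Prop :=
  ∀ i j : Fin n, i < j → u⁻¹ j < u⁻¹ i → v⁻¹ j < v⁻¹ i

theorem InvLE.permLen_sT_mul_lt {n : ℕ} {u v : Equiv.Perm (Fin n)} (h : InvLE u v) (a : ℕ)
    (hu : permLen (sT n a * u) < permLen u) : permLen (sT n a * v) < permLen v := by
  rw [permLen_sT_mul_lt_iff] at hu ⊢
  obtain ⟨ha, hu⟩ := hu
  exact ⟨ha, h _ _ (by simp [Fin.lt_def]) hu⟩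

theorem invLE_one {n : ℕ} (v : Equiv.Perm (Fin n)) : InvLE 1 v :=
  fun i j hij h => absurd (by simpa using h) (lt_asymm hij)

/-- If `s_a v < v` and `u` is below `s_a v`, then `u < s_a u` and `s_a u` is below `v`. -/
theorem InvLE.sT_mul {n : ℕ} {u v : Equiv.Perm (Fin n)} (a : ℕ) (h : InvLE u (sT n a * v))
    (hv : permLen (sT n a * v) < permLen v) :
    permLen u < permLen (sT n a * u) ∧ InvLE (sT n a * u) v := by
  obtain ⟨ha, hva⟩ := (permLen_sT_mul_lt_iff n a v).mp hv
  constructor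
  · have key : permLen (sT n a * (sT n a * u)) < permLen (sT n a * u) := by
      rw [permLen_sT_mul_lt_iff]
      refine ⟨ha, ?_⟩
      rw [sT_mul_inv_apply, sT_mul_inv_apply, sT_apply_left ha, sT_apply_right ha]
      by_contra hn
      have hne : u⁻¹ ⟨a, Nat.lt_of_succ_lt ha⟩ ≠ u⁻¹ ⟨a + 1, ha⟩ := by simp
      have := h _ _ (by simp [Fin.lt_def]) (lt_of_le_of_ne (not_lt.mp hn) hne.symm)
      rw [sT_mul_inv_apply, sT_mul_inv_apply, sT_apply_left ha, sT_apply_right ha] at this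
      exact lt_asymm this hva
    rwa [sT_mul_cancel_left] at key
  · intro i j hij hu
    rcases sT_lt_sT_or n a hij with h' | ⟨h₁, h₂⟩
    · rw [sT_mul_inv_apply, sT_mul_inv_apply] at hu
      have := h _ _ h' hu
      rwa [← sT_mul_inv_apply, ← sT_mul_inv_apply, sT_mul_cancel_left] at this
    · obtain rfl : i = ⟨a, Nat.lt_of_succ_lt ha⟩ := Fin.ext h₁
      obtain rfl : j = ⟨a + 1, ha⟩ := Fin.ext h₂
      exact hva

/-- In an arbitrary word, the first `m` letters selected for `v` are exactly the letters selected
for some `u` below `v`. -/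
theorem exists_pdsAux_eq_take (n : ℕ) (ω : List ℕ) (v : Equiv.Perm (Fin n)) (m : ℕ) :
    ∃ u : Equiv.Perm (Fin n), InvLE u v ∧ (pdsAux n u ω).2 = (pdsAux n v ω).2.take m := by
  induction ω generalizing v m with
  | nil => exact ⟨1, invLE_one v, by simp [pdsAux]⟩
  | cons a ω ih =>
    by_cases hv : permLen (sT n a * v) < permLen v
    · cases m with
      | zero => exact ⟨1, invLE_one v, by rw [pdsAux_one, List.take_zero]⟩
      | succ m =>
        obtain ⟨u, hle, hu⟩ := ih (sT n a * v) m
        obtain ⟨hlt, hle'⟩ := hle.sT_mul a hv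
        refine ⟨sT n a * u, hle', ?_⟩
        rw [pdsAux, pdsAux, sT_mul_cancel_left, if_pos hv, if_pos hlt, List.take_succ_cons, hu]
    · obtain ⟨u, hle, hu⟩ := ih v m
      refine ⟨u, hle, ?_⟩
      rw [pdsAux, pdsAux, if_neg hv, if_neg (fun h => hv (hle.permLen_sT_mul_lt a h)), hu]

/-- The set `{PDS(v) : v ∈ S_n}` of positive distinguished subexpressions within the
canonical word for `w₀` is closed under truncation: removing any number of simple
reflections from the left of `PDS(v)` again yields the PDS of some `u ∈ S_n`. -/
theorem stmt3 (n : ℕ) (v : Equiv.Perm (Fin n)) (k : ℕ) :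
    ∃ u : Equiv.Perm (Fin n), PDSw n u = (PDSw n v).drop k := by
  obtain ⟨u, -, hu⟩ := exists_pdsAux_eq_take n (w0word n).reverse v
    ((pdsAux n v (w0word n).reverse).2.length - k)
  exact ⟨u, by rw [PDSw, PDSw, pds, pds, hu, List.drop_reverse]⟩
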